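/- arXiv:1806.10304 — 3 statements merged into one kernel-verified Lean document; each statement's English description precedes it below -/
import Mathlib

section
/- Let s, k, n be any integers and m ≥ 1. Let p, q, r, a, b, c be real numbers with c ≠ 0. Let (P_n)_{n∈ℤ} = 𝒫(x)(p,q,r;a,b,c) and (U_n)_{n∈ℤ} = 𝒫(x)(0,0,1;a,b,c), and let (d_i)_{1≤i≤m}, (e_i)_{1≤i≤m} be sequences of integers. Then det( [ ∏_{f=j+1}^{m} P_{s+k(n+i+d_f)} · ∏_{g=1}^{j} P_{s+k(n+i+e_g)} ]_{0≤i,j≤m} ) = (−Δ_𝒫)^{C(m+1,2)} · (−c)^{(s+kn)·C(m+1,2) + k·C(m+1,3)} · ∏_{l=1}^{m} U_{kl}^{m+1−l} · ∏_{1≤i≤j≤m} (−c)^{k·d_j} · U_{k(e_i−d_j)}, where Δ_𝒫 is the discriminant of 𝒫(x)(p,q,r;a,b,c), C(·,·) are binomial coefficients, and powers of (−c) with (possibly negative) integer exponents are integer powers (well-defined since c ≠ 0); this is an identity in the field of rational functions ℝ(x). -/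
open Polynomial Finset

/-- A product of binary linear forms is a binary form. -/
theorem exists_coeff_prod_linear_form {ι K : Type*} [CommRing K] (S : Finset ι) (l : ι → K × K) :
    ∃ a : ℕ → K, ∀ x y : K, ∏ g ∈ S, ((l g).1 * x + (l g).2 * y)
      = ∑ t ∈ range (#S + 1), y ^ t * x ^ (#S - t) * a t := by
  classical
  induction S using Finset.induction_on with
  | empty => exact ⟨fun _ => 1, by simp⟩
  | insert g S hg ih =>
    obtain ⟨a, ha⟩ := ih
    refine ⟨fun t => (if t ≤ #S then (l g).1 * a t else 0)
      + (if t = 0 then 0 else (l g).2 * a (t - 1)), fun x y => ?_⟩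
    rw [prod_insert hg, ha, card_insert_of_notMem hg, add_mul]
    simp only [mul_add, sum_add_distrib]
    congr 1
    · rw [sum_range_succ _ (#S + 1), if_neg (by omega), mul_zero, add_zero, mul_sum]
      refine sum_congr rfl fun t ht => ?_
      have ht' : t ≤ #S := by simpa [Nat.lt_succ_iff] using ht
      rw [if_pos ht', Nat.succ_sub ht', pow_succ]
      ring
    · rw [sum_range_succ' _ (#S + 1), if_pos rfl, mul_zero, add_zero, mul_sum]
      refine sum_congr rfl fun t _ => ?_
      rw [if_neg t.succ_ne_zero, Nat.add_sub_add_right, Nat.add_sub_cancel, pow_succ]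
      ring

/-- If the columns of a matrix are binary forms of degree `m` evaluated at `m + 1` points, its
determinant is a constant multiple of the projective Vandermonde determinant of the points. -/
theorem exists_det_prod_linear_form {K : Type*} [CommRing K] (m : ℕ)
    (l : Fin (m + 1) → ℕ → K × K) :
    ∃ κ : K, ∀ v w : Fin (m + 1) → K,
      (Matrix.of fun i j : Fin (m + 1) =>
        ∏ g ∈ range m, ((l j g).1 * v i + (l j g).2 * w i)).det
      = (∏ i, ∏ j ∈ Ioi i, (v i * w j - v j * w i)) * κ := by
  choose a ha using fun j => exists_coeff_prod_linear_form (range m) (l j)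
  refine ⟨(Matrix.of fun t j : Fin (m + 1) => a j t).det, fun v w => ?_⟩
  have hV : (Matrix.projVandermonde w v).det = ∏ i, ∏ j ∈ Ioi i, (v i * w j - v j * w i) := by
    rw [Matrix.det_projVandermonde]
    exact prod_congr rfl fun i _ => prod_congr rfl fun j _ => by ring
  rw [← hV, ← Matrix.det_mul]
  congr 1
  ext i j
  simp only [Matrix.of_apply, Matrix.mul_apply, Matrix.projVandermonde_apply, ha, card_range,
    Fin.val_rev, Nat.add_sub_add_right]
  exact sum_range fun t => w i ^ t * v i ^ (m - t) * a j t

/-- A homogeneous version of Krattenthaler's determinant evaluation. -/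
theorem det_prod_linear_form {K : Type*} [Field K] [CharZero K] (m : ℕ) (L M : ℕ → K × K)
    (v w : Fin (m + 1) → K) :
    (Matrix.of fun i j : Fin (m + 1) => ∏ g ∈ range m,
      ((if g < j.1 then M g else L g).1 * v i + (if g < j.1 then M g else L g).2 * w i)).det
    = (∏ i, ∏ j ∈ Ioi i, (v i * w j - v j * w i))
      * ∏ j ∈ range m, ∏ i ∈ range (j + 1), ((M i).2 * (L j).1 - (M i).1 * (L j).2) := by
  induction m generalizing L M with
  | zero => simp
  | succ m ih =>
    by_cases hM : M 0 = 0
    · rw [Matrix.det_eq_zero_of_column_eq_zero (Fin.last _), prod_eq_zero (mem_range.2 m.succ_pos),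
        mul_zero]
      · exact prod_eq_zero (i := 0) (by simp) (by simp [hM])
      · intro i
        rw [Matrix.of_apply]
        exact prod_eq_zero (i := 0) (by simp) (by simp [hM])
    obtain ⟨κ, hκ⟩ := exists_det_prod_linear_form (m + 1)
      (fun j g => if g < j.1 then M g else L g)
    rw [hκ]
    congr 1
    obtain ⟨x, y, hxy⟩ : ∃ x y : K, (M 0).1 * x + (M 0).2 * y ≠ 0 := by
      by_contra! h
      exact hM (Prod.ext (by simpa using h 1 0) (by simpa using h 0 1))
    -- Pairwise independent points at which `M 0` takes the same nonzero value.
    let v' : Fin (m + 1) → K := fun i => x + i.1 * (M 0).2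
    let w' : Fin (m + 1) → K := fun i => y - i.1 * (M 0).1
    have hM' (i) : (M 0).1 * v' i + (M 0).2 * w' i = (M 0).1 * x + (M 0).2 * y := by
      simp only [v', w']; ring
    have hV : ∏ i, ∏ j ∈ Ioi i, (v' i * w' j - v' j * w' i) ≠ 0 := by
      refine prod_ne_zero_iff.2 fun i _ => prod_ne_zero_iff.2 fun j hj => ?_
      have hij : (i.1 : K) - j.1 ≠ 0 := by
        rw [sub_ne_zero, Ne, Nat.cast_inj]
        exact fun h => (mem_Ioi.1 hj).ne (Fin.ext h)
      convert mul_ne_zero hij hxy using 1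
      simp only [v', w']; ring
    have hcons := hκ (Fin.cons (M 0).2 v') (Fin.cons (-(M 0).1) w')
    have hrec := ih (fun g => L (g + 1)) (fun g => M (g + 1)) v' w'
    rw [Matrix.det_succ_row_zero, sum_eq_single 0] at hcons
    rotate_left
    · intro j _ hj
      rw [Matrix.of_apply, prod_eq_zero (i := 0) (by simp), mul_zero, zero_mul]
      rw [if_pos (by simpa [Fin.pos_iff_ne_zero] using hj)]
      simp; ring
    · simp
    have hsub : (Matrix.submatrix (Matrix.of fun i j : Fin (m + 1 + 1) => ∏ g ∈ range (m + 1),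
          ((if g < j.1 then M g else L g).1 * (Fin.cons (M 0).2 v' : Fin (m + 2) → K) i
            + (if g < j.1 then M g else L g).2 * (Fin.cons (-(M 0).1) w' : Fin (m + 2) → K) i))
          Fin.succ (Fin.succAbove 0))
        = Matrix.of fun i j => ((M 0).1 * v' i + (M 0).2 * w' i)
          * (Matrix.of fun i j : Fin (m + 1) => ∏ g ∈ range m,
          ((if g < j.1 then M (g + 1) else L (g + 1)).1 * v' i
            + (if g < j.1 then M (g + 1) else L (g + 1)).2 * w' i)) i j := by
      ext i j
      simp [prod_range_succ', mul_comm]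
    have hVcons : ∏ i, ∏ j ∈ Ioi i, ((Fin.cons (M 0).2 v' : Fin (m + 2) → K) i
          * (Fin.cons (-(M 0).1) w' : Fin (m + 2) → K) j
          - (Fin.cons (M 0).2 v' : Fin (m + 2) → K) j
          * (Fin.cons (-(M 0).1) w' : Fin (m + 2) → K) i)
        = (∏ i, ((M 0).1 * v' i + (M 0).2 * w' i))
          * ∏ i, ∏ j ∈ Ioi i, (v' i * w' j - v' j * w' i) := by
      rw [Fin.prod_univ_succ, Fin.prod_Ioi_zero]
      simp only [Fin.prod_Ioi_succ, Fin.cons_zero, Fin.cons_succ]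
      congr 1
      exact prod_congr rfl fun i _ => by ring
    rw [hsub, Matrix.det_mul_column, hrec, hVcons] at hcons
    simp only [Fin.cons_zero, Matrix.of_apply, Fin.val_zero, pow_zero, one_mul, not_lt_zero,
      if_false] at hcons
    have hP : ∏ i, ((M 0).1 * v' i + (M 0).2 * w' i) ≠ 0 :=
      prod_ne_zero_iff.2 fun i _ => by rwa [hM']
    refine mul_left_cancel₀ (mul_ne_zero hP hV) (hcons.symm.trans ?_)
    have hsplit : ∏ j ∈ range (m + 1), ∏ i ∈ range (j + 1),
          ((M i).2 * (L j).1 - (M i).1 * (L j).2)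
        = (∏ j ∈ range (m + 1), ((L j).1 * (M 0).2 + (L j).2 * -(M 0).1))
          * ∏ j ∈ range m, ∏ i ∈ range (j + 1),
            ((M (i + 1)).2 * (L (j + 1)).1 - (M (i + 1)).1 * (L (j + 1)).2) := by
      simp only [fun j => prod_range_succ' (fun i => (M i).2 * (L j).1 - (M i).1 * (L j).2) j,
        prod_mul_distrib]
      rw [prod_range_succ' (fun j => ∏ i ∈ range j, _), range_zero, prod_empty, mul_one, mul_comm]
      congr 1
      exact prod_congr rfl fun j _ => by ring
    rw [hsplit]
    ring

theorem eq_zpow_mul_of_forall_add_one {K : Type*} [Field K] {y : K} (hy : y ≠ 0) {f : ℤ → K}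
    (hf : ∀ n, f (n + 1) = y * f n) (n : ℤ) : f n = y ^ n * f 0 := by
  induction n using Int.induction_on with
  | zero => simp
  | succ n ih => rw [hf, ih, zpow_add_one₀ hy]; ring
  | pred n ih =>
    have h := hf (-n - 1)
    rw [sub_add_cancel, ih] at h
    rw [zpow_sub_one₀ hy, mul_right_comm, h]
    field_simp

theorem eq_of_two_term_recurrence {K : Type*} [Field K] {T c : K} (hc : c ≠ 0) {f g : ℤ → K}
    (hf : ∀ n, f (n + 2) = T * f (n + 1) + c * f n)
    (hg : ∀ n, g (n + 2) = T * g (n + 1) + c * g n)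
    (h0 : f 0 = g 0) (h1 : f 1 = g 1) (n : ℤ) : f n = g n := by
  suffices h : f n = g n ∧ f (n + 1) = g (n + 1) from h.1
  induction n using Int.induction_on with
  | zero => exact ⟨h0, by simpa using h1⟩
  | succ n ih =>
    refine ⟨ih.2, ?_⟩
    rw [add_assoc, one_add_one_eq_two, hf, hg, ih.1, ih.2]
  | pred n ih =>
    have hf' := hf (-n - 1)
    have hg' := hg (-n - 1)
    rw [show -(n : ℤ) - 1 + 2 = -n + 1 by ring, sub_add_cancel] at hf' hg'
    rw [sub_add_cancel]
    refine ⟨mul_left_cancel₀ hc ?_, ih.1⟩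
    linear_combination hg' - hf' + ih.2 - T * ih.1

theorem mul_fundamental_neg_one {K : Type*} [Field K] {T c : K} {U : ℤ → K}
    (hU : ∀ n, U (n + 2) = T * U (n + 1) + c * U n) (hU0 : U 0 = 0) (hU1 : U 1 = 1) :
    c * U (-1) = 1 := by
  have h := hU (-1)
  norm_num [hU0, hU1] at h
  exact h.symm

theorem two_term_recurrence_add {K : Type*} [Field K] {T c : K} (hc : c ≠ 0) {P U : ℤ → K}
    (hP : ∀ n, P (n + 2) = T * P (n + 1) + c * P n)
    (hU : ∀ n, U (n + 2) = T * U (n + 1) + c * U n) (hU0 : U 0 = 0) (hU1 : U 1 = 1) (n t : ℤ) :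
    P (n + t) = c * U (t - 1) * P n + U t * P (n + 1) := by
  refine eq_of_two_term_recurrence (T := T) hc (f := fun t => P (n + t))
    (g := fun t => c * U (t - 1) * P n + U t * P (n + 1)) (fun t => ?_) (fun t => ?_) ?_ ?_ t
  · simpa only [add_assoc] using hP (n + t)
  · have h := hU (t - 1)
    rw [show t - 1 + 2 = t + 2 - 1 by ring, sub_add_cancel] at h
    simp only [add_sub_cancel_right, hU t, h]
    ring
  · simp [mul_fundamental_neg_one hU hU0 hU1, hU0]
  · simp [hU0, hU1]

theorem casoratian_eq {K : Type*} [Field K] {T c : K} (hc : c ≠ 0) {P : ℤ → K}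
    (hP : ∀ n, P (n + 2) = T * P (n + 1) + c * P n) (n : ℤ) :
    P (n + 1) ^ 2 - T * P n * P (n + 1) - c * P n ^ 2
      = (-c) ^ n * (P 1 ^ 2 - T * P 0 * P 1 - c * P 0 ^ 2) := by
  have h := eq_zpow_mul_of_forall_add_one (neg_ne_zero.2 hc)
    (f := fun n => P (n + 1) ^ 2 - T * P n * P (n + 1) - c * P n ^ 2) (fun n => ?_) n
  · simpa using h
  · simp only [add_assoc, one_add_one_eq_two, hP n]
    ring

theorem det_consecutive_eq {K : Type*} [Field K] {T c : K} (hc : c ≠ 0) {P U : ℤ → K}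
    (hP : ∀ n, P (n + 2) = T * P (n + 1) + c * P n)
    (hU : ∀ n, U (n + 2) = T * U (n + 1) + c * U n) (hU0 : U 0 = 0) (hU1 : U 1 = 1) (n t : ℤ) :
    P n * P (n + t + 1) - P (n + t) * P (n + 1)
      = -(P 1 ^ 2 - T * P 0 * P 1 - c * P 0 ^ 2) * (-c) ^ n * U t := by
  have hadd := two_term_recurrence_add hc hP hU hU0 hU1 n
  have h := hU (t - 1)
  rw [show t - 1 + 2 = t + 1 by ring, sub_add_cancel] at h
  rw [add_assoc, hadd (t + 1), hadd t, add_sub_cancel_right, h]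
  linear_combination -U t * casoratian_eq hc hP n

theorem det_fundamental_eq {K : Type*} [Field K] {T c : K} (hc : c ≠ 0) {U : ℤ → K}
    (hU : ∀ n, U (n + 2) = T * U (n + 1) + c * U n) (hU0 : U 0 = 0) (hU1 : U 1 = 1) (t u : ℤ) :
    U t * (c * U (u - 1)) - c * U (t - 1) * U u = (-c) ^ u * U (t - u) := by
  have h := eq_zpow_mul_of_forall_add_one (neg_ne_zero.2 hc)
    (f := fun n => U (t - u + n) * (c * U (n - 1)) - c * U (t - u + n - 1) * U n) (fun n => ?_) u
  · simpa [hU0, mul_fundamental_neg_one hU hU0 hU1] using h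
  · have h₁ := hU (t - u + n - 1)
    have h₂ := hU (n - 1)
    rw [show t - u + n - 1 + 2 = t - u + (n + 1) by ring, sub_add_cancel] at h₁
    rw [show n - 1 + 2 = n + 1 by ring, sub_add_cancel] at h₂
    simp only [h₁, h₂, add_sub_cancel_right, show t - u + (n + 1) - 1 = t - u + n by ring]
    ring

theorem prod_pairs_eq {K : Type*} [Field K] {y : K} (hy : y ≠ 0) (x : K) (F : ℕ → K)
    (k : ℤ) (m : ℕ) (B : ℤ) :
    ∏ i : Fin (m + 1), ∏ j ∈ Ioi i, (x * y ^ (B + k * (i.1 : ℤ)) * F (j.1 - i.1))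
      = x ^ (m + 1).choose 2 * y ^ (B * ((m + 1).choose 2 : ℤ) + k * ((m + 1).choose 3 : ℤ))
        * ∏ l ∈ Icc 1 m, F l ^ (m + 1 - l) := by
  induction m generalizing B with
  | zero => simp [Nat.choose]
  | succ m ih =>
    have hF : ∏ l ∈ Icc 1 (m + 1), F l ^ (m + 1 + 1 - l)
        = (∏ l ∈ Icc 1 m, F l ^ (m + 1 - l)) * ∏ j : Fin (m + 1), F (j.1 + 1) := by
      rw [← prod_range fun j => F (j + 1), range_eq_Ico, prod_Ico_add' F 0 (m + 1) 1, zero_add,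
        Ico_add_one_right_eq_Icc, prod_Icc_succ_top (by omega), prod_Icc_succ_top (by omega),
        ← mul_assoc, ← prod_mul_distrib]
      congr 1
      · refine prod_congr rfl fun l hl => ?_
        rw [← pow_succ]
        congr 1
        have := (mem_Icc.1 hl).2
        omega
      · simp
    rw [Fin.prod_univ_succ, Fin.prod_Ioi_zero]
    simp only [Fin.prod_Ioi_succ, Fin.val_succ, Fin.val_zero, Nat.add_sub_add_right, Nat.sub_zero,
      Nat.cast_add, Nat.cast_one, Nat.cast_zero, mul_zero, add_zero]
    have ih' := ih (B + k)
    simp only [show ∀ i : ℤ, B + k + k * i = B + k * (i + 1) from fun i => by ring] at ih'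
    rw [ih', hF, prod_mul_distrib, prod_const, card_univ, Fintype.card_fin, mul_pow,
      ← zpow_natCast (y ^ B), ← zpow_mul, Nat.choose_succ_succ' (m + 1) 1,
      Nat.choose_succ_succ' (m + 1) 2, Nat.choose_one_right, pow_add]
    have hz : y ^ (B * ((m + 1 : ℕ) : ℤ))
        * y ^ ((B + k) * ((m + 1).choose 2 : ℤ) + k * ((m + 1).choose 3 : ℤ))
        = y ^ (B * ((m + 1 + (m + 1).choose (1 + 1) : ℕ) : ℤ)
          + k * (((m + 1).choose 2 + (m + 1).choose (2 + 1) : ℕ) : ℤ)) := by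
      rw [← zpow_add₀ hy]
      congr 1
      push_cast
      ring
    rw [← hz]
    ring

theorem prod_Icc_one_eq_prod_range {K : Type*} [CommMonoid K] (f : ℕ → K) (m : ℕ) :
    ∏ i ∈ Icc 1 m, f i = ∏ i ∈ range m, f (i + 1) := by
  rw [range_eq_Ico, prod_Ico_add' f 0 m 1, zero_add, Ico_add_one_right_eq_Icc]

theorem prod_Icc_mul_prod_Icc_eq {K : Type*} [CommMonoid K] (f g : ℕ → K) {m j : ℕ} (hj : j ≤ m) :
    (∏ i ∈ Icc (j + 1) m, f i) * ∏ i ∈ Icc 1 j, g i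
      = ∏ i ∈ range m, if i < j then g (i + 1) else f (i + 1) := by
  rw [prod_Icc_one_eq_prod_range, ← prod_range_mul_prod_Ico _ hj, mul_comm]
  congr 1
  · exact prod_congr rfl fun i hi => by rw [if_pos (mem_range.1 hi)]
  · rw [← Ico_add_one_right_eq_Icc, ← prod_Ico_add' f j m 1]
    exact prod_congr rfl fun i hi => by rw [if_neg (mem_Ico.1 hi).1.not_gt]

theorem det_prod_two_term_recurrence {K : Type*} [Field K] [CharZero K] {T c : K} (hc : c ≠ 0)
    {P U : ℤ → K}
    (hP : ∀ n, P (n + 2) = T * P (n + 1) + c * P n)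
    (hU : ∀ n, U (n + 2) = T * U (n + 1) + c * U n) (hU0 : U 0 = 0) (hU1 : U 1 = 1)
    (s k n : ℤ) (m : ℕ) (d e : ℕ → ℤ) :
    (Matrix.of fun i j : Fin (m + 1) =>
        (∏ f ∈ Icc (j.1 + 1) m, P (s + k * (n + i.1 + d f)))
          * ∏ g ∈ Icc 1 j.1, P (s + k * (n + i.1 + e g))).det
      = (-(P 1 ^ 2 - T * P 0 * P 1 - c * P 0 ^ 2)) ^ (m + 1).choose 2
        * (-c) ^ ((s + k * n) * ((m + 1).choose 2 : ℤ) + k * ((m + 1).choose 3 : ℤ))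
        * (∏ l ∈ Icc 1 m, U (k * (l : ℤ)) ^ (m + 1 - l))
        * ∏ j ∈ Icc 1 m, ∏ i ∈ Icc 1 j, ((-c) ^ (k * d j) * U (k * (e i - d j))) := by
  have hdet := det_prod_linear_form m
    (fun f => (c * U (k * d (f + 1) - 1), U (k * d (f + 1))))
    (fun g => (c * U (k * e (g + 1) - 1), U (k * e (g + 1))))
    (fun i => P (s + k * n + k * (i.1 : ℤ))) (fun i => P (s + k * n + k * (i.1 : ℤ) + 1))
  have hadd := two_term_recurrence_add hc hP hU hU0 hU1
  calc _ = _ := by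
        congr 2
        ext i j
        rw [prod_Icc_mul_prod_Icc_eq _ _ (Nat.lt_succ_iff.1 j.2)]
        refine prod_congr rfl fun g _ => ?_
        split_ifs
        all_goals rw [← hadd]; congr 1; ring
    _ = _ := hdet
    _ = _ := by
        congr 1
        · rw [← prod_pairs_eq (neg_ne_zero.2 hc) _ (fun l => U (k * (l : ℤ)))]
          refine prod_congr rfl fun i _ => prod_congr rfl fun j hj => ?_
          rw [← det_consecutive_eq hc hP hU hU0 hU1, Nat.cast_sub (mem_Ioi.1 hj).le]
          simp only [show s + k * n + k * (i.1 : ℤ) + k * ((j.1 : ℤ) - i.1)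
            = s + k * n + k * (j.1 : ℤ) by ring]
        · rw [prod_Icc_one_eq_prod_range]
          refine prod_congr rfl fun j _ => ?_
          rw [prod_Icc_one_eq_prod_range]
          refine prod_congr rfl fun i _ => ?_
          rw [mul_sub, ← det_fundamental_eq hc hU hU0 hU1]

/-- **Theorem 3.** For `P = 𝒫(x)(p,q,r;a,b,c)` and `U = 𝒫(x)(0,0,1;a,b,c)` with `c ≠ 0`
and integer sequences `(d_i)`, `(e_i)`,
`det([∏_{f=j+1}^m P_{s+k(n+i+d_f)} · ∏_{g=1}^j P_{s+k(n+i+e_g)}])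
 = (−Δ_𝒫)^{C(m+1,2)} (−c)^{(s+kn)C(m+1,2)+kC(m+1,3)} ∏_{l=1}^m U_{kl}^{m+1−l}
   · ∏_{1≤i≤j≤m} (−c)^{k d_j} U_{k(e_i−d_j)}`, as an identity in `ℝ(x)`. -/
theorem det_product_matrix_recurrence_polynomials
    (s k n : ℤ) (m : ℕ) (hm : 1 ≤ m)
    (p q r a b c : ℝ) (hc : c ≠ 0)
    (P U : ℤ → Polynomial ℝ)
    (hP0 : P 0 = Polynomial.C p) (hP1 : P 1 = Polynomial.C q * X + Polynomial.C r)
    (hPrec : ∀ n : ℤ, P (n + 2) = (Polynomial.C a * X + Polynomial.C b) * P (n + 1)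
      + Polynomial.C c * P n)
    (hU0 : U 0 = 0) (hU1 : U 1 = 1)
    (hUrec : ∀ n : ℤ, U (n + 2) = (Polynomial.C a * X + Polynomial.C b) * U (n + 1)
      + Polynomial.C c * U n)
    (d e : ℕ → ℤ) :
    Matrix.det (Matrix.of fun i j : Fin (m + 1) =>
        algebraMap (Polynomial ℝ) (RatFunc ℝ)
          ((∏ f ∈ Finset.Icc (j.1 + 1) m, P (s + k * (n + i.1 + d f)))
            * ∏ g ∈ Finset.Icc 1 j.1, P (s + k * (n + i.1 + e g))))
      = (-(algebraMap (Polynomial ℝ) (RatFunc ℝ)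
            (Polynomial.C (q ^ 2 - a * p * q) * X ^ 2
              + Polynomial.C (2 * q * r - a * p * r - b * p * q) * X
              + Polynomial.C (r ^ 2 - b * p * r - c * p ^ 2)))) ^ (Nat.choose (m + 1) 2)
        * (-(algebraMap ℝ (RatFunc ℝ) c))
            ^ ((s + k * n) * (Nat.choose (m + 1) 2 : ℤ) + k * (Nat.choose (m + 1) 3 : ℤ))
        * (∏ l ∈ Finset.Icc 1 m,
            (algebraMap (Polynomial ℝ) (RatFunc ℝ) (U (k * (l : ℤ)))) ^ (m + 1 - l))
        * ∏ j ∈ Finset.Icc 1 m, ∏ i ∈ Finset.Icc 1 j,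
            ((-(algebraMap ℝ (RatFunc ℝ) c)) ^ (k * d j)
              * algebraMap (Polynomial ℝ) (RatFunc ℝ) (U (k * (e i - d j)))) := by
  have hφC (t : ℝ) : algebraMap ℝ[X] (RatFunc ℝ) (Polynomial.C t) = algebraMap ℝ (RatFunc ℝ) t :=
    (IsScalarTower.algebraMap_apply ℝ ℝ[X] (RatFunc ℝ) t).symm
  have hc' : algebraMap ℝ (RatFunc ℝ) c ≠ 0 := by simpa using hc
  have hφ {V : ℤ → ℝ[X]}
      (hV : ∀ n, V (n + 2) = (Polynomial.C a * X + Polynomial.C b) * V (n + 1)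
        + Polynomial.C c * V n) (n : ℤ) :
      algebraMap ℝ[X] (RatFunc ℝ) (V (n + 2))
        = algebraMap ℝ[X] (RatFunc ℝ) (Polynomial.C a * X + Polynomial.C b)
            * algebraMap ℝ[X] (RatFunc ℝ) (V (n + 1))
          + algebraMap ℝ (RatFunc ℝ) c * algebraMap ℝ[X] (RatFunc ℝ) (V n) := by
    rw [hV, map_add, map_mul, map_mul, hφC]
  have hdisc : algebraMap ℝ[X] (RatFunc ℝ)
        (Polynomial.C (q ^ 2 - a * p * q) * X ^ 2
          + Polynomial.C (2 * q * r - a * p * r - b * p * q) * X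
          + Polynomial.C (r ^ 2 - b * p * r - c * p ^ 2))
      = algebraMap ℝ[X] (RatFunc ℝ) (P 1) ^ 2
        - algebraMap ℝ[X] (RatFunc ℝ) (Polynomial.C a * X + Polynomial.C b)
          * algebraMap ℝ[X] (RatFunc ℝ) (P 0) * algebraMap ℝ[X] (RatFunc ℝ) (P 1)
        - algebraMap ℝ (RatFunc ℝ) c * algebraMap ℝ[X] (RatFunc ℝ) (P 0) ^ 2 := by
    rw [← hφC c, hP0, hP1]
    simp only [← map_mul, ← map_pow, ← map_sub]
    congr 1
    simp only [map_sub, map_mul, map_pow, map_ofNat]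
    ring
  have hdet := det_prod_two_term_recurrence hc'
    (P := fun i => algebraMap ℝ[X] (RatFunc ℝ) (P i))
    (U := fun i => algebraMap ℝ[X] (RatFunc ℝ) (U i)) (hφ hPrec) (hφ hUrec) (by rw [hU0, map_zero])
    (by rw [hU1, map_one]) s k n m d e
  rw [hdisc, ← hdet]
  simp only [map_mul, map_prod]
end

section
/- Let s, k, n be any integers and m ≥ 1. Let p, q, r, a, b, c be real numbers with c ≠ 0. Let (P_n)_{n∈ℤ} = 𝒫(x)(p,q,r;a,b,c) and (U_n)_{n∈ℤ} = 𝒫(x)(0,0,1;a,b,c). Assume P_{s+k(n+i+j)} is a nonzero polynomial for every 0 ≤ i, j ≤ m. Then, in the field of rational functions ℝ(x), det( [ 1 / P_{s+k(n+i+j)} ]_{0≤i,j≤m} ) = ( (−1)^{(s+kn)·C(m+1,2)} · c^{(s+kn)·C(m+1,2) + 2k·C(m+1,3)} · Δ_𝒫^{C(m+1,2)} · ∏_{i=0}^{m} U_{k(i+1)}^{2(m−i)} ) / ( ∏_{0≤i,j≤m} P_{s+k(n+i+j)} ), where Δ_𝒫 is the discriminant of 𝒫(x)(p,q,r;a,b,c),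 C(·,·) are binomial coefficients, and powers of −1 and c with (possibly negative) integer exponents are integer powers (well-defined since c ≠ 0). -/
open Polynomial Finset

/-- Schur complement of the top-left entry. -/
lemma Matrix.det_succ_eq_mul_det_schur {K : Type*} [Field K] {m : ℕ}
    (M : Matrix (Fin (m + 1)) (Fin (m + 1)) K) (h : M 0 0 ≠ 0) :
    M.det = M 0 0 * (Matrix.of fun i j : Fin m =>
      M i.succ j.succ - M i.succ 0 / M 0 0 * M 0 j.succ).det := by
  have hdet := Matrix.det_eq_of_forall_row_eq_smul_add_const
    (A := M) (B := Matrix.of fun i j => M i j - (if i = 0 then 0 else M i 0 / M 0 0) * M 0 j)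
    (fun i => if i = 0 then 0 else M i 0 / M 0 0) 0 (by simp)
    (fun i j => by simp)
  rw [hdet, Matrix.det_succ_column_zero, Fin.sum_univ_succ, Finset.sum_eq_zero]
  · simp only [Fin.val_zero, pow_zero, Matrix.of_apply, if_true, zero_mul, sub_zero, one_mul,
      add_zero]
    congr 2
  · intro i _
    simp [Fin.succ_ne_zero, div_mul_cancel₀ _ h]

/-- A solution of a two-sided linear recurrence of order two is determined by its values at
`0` and `1`. -/
lemma eq_zero_of_linear_recurrence {K : Type*} [Field K] {l c : K} (hc : c ≠ 0) {h : ℤ → K}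
    (hrec : ∀ n, h (n + 2) = l * h (n + 1) + c * h n) (h0 : h 0 = 0) (h1 : h 1 = 0) (n : ℤ) :
    h n = 0 := by
  suffices H : h n = 0 ∧ h (n + 1) = 0 from H.1
  induction n using Int.induction_on with
  | zero => exact ⟨h0, by simpa using h1⟩
  | succ i ih =>
    refine ⟨ih.2, ?_⟩
    rw [add_assoc, one_add_one_eq_two, hrec, ih.1, ih.2]
    simp
  | pred i ih =>
    have e := hrec (-(i : ℤ) - 1)
    rw [show -(i : ℤ) - 1 + 2 = -i + 1 by ring, show -(i : ℤ) - 1 + 1 = -i by ring,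
      ih.1, ih.2] at e
    refine ⟨?_, by rw [sub_add_cancel]; exact ih.1⟩
    simpa [hc] using e.symm

/-- Catalan-type identity at consecutive indices. -/
lemma sq_sub_mul_of_linear_recurrence {K : Type*} [Field K] {l c : K} (hc : c ≠ 0) {f : ℤ → K}
    (hf : ∀ n, f (n + 2) = l * f (n + 1) + c * f n) (n : ℤ) :
    f (n + 1) ^ 2 - f n * f (n + 2) = (-c) ^ n * (f 1 ^ 2 - f 0 * f 2) := by
  have hc' : -c ≠ 0 := neg_ne_zero.mpr hc
  have step (n : ℤ) : f (n + 1 + 1) ^ 2 - f (n + 1) * f (n + 1 + 2) =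
      -c * (f (n + 1) ^ 2 - f n * f (n + 2)) := by
    rw [hf (n + 1), add_assoc n 1 1, one_add_one_eq_two, hf n]
    ring
  induction n using Int.induction_on with
  | zero => simp
  | succ i ih => rw [step, ih, zpow_add_one₀ hc']; ring
  | pred i ih =>
    have e := step (-(i : ℤ) - 1)
    rw [sub_add_cancel, ih] at e
    rw [zpow_sub_one₀ hc', sub_add_cancel]
    apply mul_left_cancel₀ hc'
    rw [← e]
    field_simp

/-- Catalan-type identity relating an arbitrary solution `f` of a linear recurrence to its
fundamental solution `g`. -/
lemma mul_sub_mul_of_linear_recurrence {K : Type*} [Field K] {l c : K} (hc : c ≠ 0)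
    {f g : ℤ → K} (hf : ∀ n, f (n + 2) = l * f (n + 1) + c * f n)
    (hg : ∀ n, g (n + 2) = l * g (n + 1) + c * g n) (hg0 : g 0 = 0) (hg1 : g 1 = 1)
    (n i j : ℤ) :
    f (n + i) * f (n + j) - f n * f (n + i + j) =
      (-c) ^ n * (f 1 ^ 2 - f 0 * f 2) * (g i * g j) := by
  have key (i : ℤ) : f (n + i) * f (n + 1) - f n * f (n + i + 1) =
      (-c) ^ n * (f 1 ^ 2 - f 0 * f 2) * g i := by
    rw [← sub_eq_zero]
    refine eq_zero_of_linear_recurrence (l := l) hc (h := fun i =>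
      f (n + i) * f (n + 1) - f n * f (n + i + 1) - (-c) ^ n * (f 1 ^ 2 - f 0 * f 2) * g i)
      (fun i => ?_) ?_ ?_ i
    · rw [hg i, show n + (i + 2) + 1 = (n + i + 1) + 2 by ring, ← add_assoc n i 2, hf (n + i),
        hf (n + i + 1), ← add_assoc n i 1]
      ring
    · simp [hg0, mul_comm]
    · have e := sq_sub_mul_of_linear_recurrence hc hf n
      rw [hg1, ← e, add_assoc n 1 1, one_add_one_eq_two]
      ring
  rw [← sub_eq_zero]
  refine eq_zero_of_linear_recurrence (l := l) hc (h := fun j =>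
    f (n + i) * f (n + j) - f n * f (n + i + j) -
      (-c) ^ n * (f 1 ^ 2 - f 0 * f 2) * (g i * g j)) (fun j => ?_) ?_ ?_ j
  · rw [hg j, ← add_assoc n j 2, ← add_assoc (n + i) j 2, hf (n + j), hf (n + i + j),
      ← add_assoc n j 1, ← add_assoc (n + i) j 1]
    ring
  · simp [hg0, mul_comm]
  · simp [hg1, key]

/-- Determinant of the Hankel matrix of reciprocals of a sequence satisfying a Catalan-type
identity. -/
lemma det_inv_hankel_of_catalan {K : Type*} [Field K] {e D : K} (he : e ≠ 0) {f g : ℤ → K} (k : ℤ)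
    (hfg : ∀ n i j, f (n + i) * f (n + j) - f n * f (n + i + j) = e ^ n * D * (g i * g j))
    (m : ℕ) (N : ℤ) (hne : ∀ i j : Fin (m + 1), f (N + k * i.1 + k * j.1) ≠ 0) :
    (Matrix.of fun i j : Fin (m + 1) => (f (N + k * i.1 + k * j.1))⁻¹).det =
      (e ^ (N * ((m + 1).choose 2 : ℤ) + 2 * k * ((m + 1).choose 3 : ℤ)) *
          D ^ (m + 1).choose 2 *
          ∏ i ∈ range (m + 1), g (k * ((i : ℤ) + 1)) ^ (2 * (m - i))) /
        ∏ i ∈ range (m + 1), ∏ j ∈ range (m + 1), f (N + k * i + k * j) := by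
  induction m generalizing N with
  | zero => simp [Nat.choose_eq_zero_of_lt]
  | succ m ih =>
    have hN : f N ≠ 0 := by simpa using hne 0 0
    have hrow (i : Fin (m + 1)) : f (N + k * (i.1 + 1)) ≠ 0 := by simpa using hne i.succ 0
    have hsub (i j : Fin (m + 1)) : f (N + 2 * k + k * i.1 + k * j.1) ≠ 0 := by
      have h := hne i.succ j.succ
      rwa [show N + k * ((i.succ : Fin (m + 2)) : ℕ) + k * ((j.succ : Fin (m + 2)) : ℕ) =
        N + 2 * k + k * i.1 + k * j.1 by push_cast [Fin.val_succ]; ring] at h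
    have hentry : (Matrix.of fun i j : Fin (m + 1) =>
          (f (N + k * (i.succ : Fin (m + 2)).1 + k * (j.succ : Fin (m + 2)).1))⁻¹ -
            (f (N + k * (i.succ : Fin (m + 2)).1))⁻¹ / (f N)⁻¹ *
              (f (N + k * (j.succ : Fin (m + 2)).1))⁻¹) =
        Matrix.of fun i j : Fin (m + 1) =>
          (e ^ N * D * g (k * (i.1 + 1)) / f (N + k * (i.1 + 1))) *
            (Matrix.of fun i j : Fin (m + 1) =>
              (g (k * (j.1 + 1)) / f (N + k * (j.1 + 1))) *
                (Matrix.of fun i j : Fin (m + 1) => (f (N + 2 * k + k * i.1 + k * j.1))⁻¹) i j)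
              i j := by
      ext i j
      have h := hfg N (k * (i.1 + 1)) (k * (j.1 + 1))
      have e2 : N + k * ((i.1 : ℤ) + 1) + k * (j.1 + 1) = N + 2 * k + k * i.1 + k * j.1 := by ring
      have h1 := hrow i
      have h2 := hrow j
      have h3 := hsub i j
      simp only [Matrix.of_apply, Fin.val_succ, Nat.cast_add, Nat.cast_one]
      rw [e2] at h ⊢
      field_simp
      linear_combination h
    rw [Matrix.det_succ_eq_mul_det_schur _ (by simpa using hN)]
    simp only [Matrix.of_apply, Fin.val_zero, Nat.cast_zero, mul_zero, add_zero]
    rw [hentry, Matrix.det_mul_column, Matrix.det_mul_row, ih (N + 2 * k) hsub,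
      Fin.prod_univ_eq_prod_range
        (fun i : ℕ => e ^ N * D * g (k * ((i : ℤ) + 1)) / f (N + k * ((i : ℤ) + 1))),
      Fin.prod_univ_eq_prod_range
        (fun i : ℕ => g (k * ((i : ℤ) + 1)) / f (N + k * ((i : ℤ) + 1)))]
    have hg : ∏ i ∈ range (m + 1 + 1), g (k * ((i : ℤ) + 1)) ^ (2 * (m + 1 - i)) =
        (∏ i ∈ range (m + 1), g (k * ((i : ℤ) + 1))) ^ 2 *
          ∏ i ∈ range (m + 1), g (k * ((i : ℤ) + 1)) ^ (2 * (m - i)) := by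
      rw [prod_range_succ, Nat.sub_self, mul_zero, pow_zero, mul_one, ← prod_pow,
        ← prod_mul_distrib]
      refine prod_congr rfl fun i hi => ?_
      rw [← pow_add]
      congr 1
      have := mem_range.mp hi
      omega
    have hf : ∏ i ∈ range (m + 1 + 1), ∏ j ∈ range (m + 1 + 1), f (N + k * i + k * j) =
        f N * (∏ i ∈ range (m + 1), f (N + k * ((i : ℤ) + 1))) ^ 2 *
          ∏ i ∈ range (m + 1), ∏ j ∈ range (m + 1), f (N + 2 * k + k * i + k * j) := by
      rw [prod_range_succ']
      simp only [prod_range_succ' _ (m + 1), prod_mul_distrib, Nat.cast_zero, mul_zero, add_zero,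
        Nat.cast_add, Nat.cast_one]
      simp only [show ∀ i j : ℕ, N + k * ((i : ℤ) + 1) + k * ((j : ℤ) + 1) =
        N + 2 * k + k * i + k * j from fun i j => by ring]
      ring
    have hexp : e ^ (N * ((m + 1 + 1).choose 2 : ℤ) + 2 * k * ((m + 1 + 1).choose 3 : ℤ)) =
        (e ^ N) ^ (m + 1) *
          e ^ ((N + 2 * k) * ((m + 1).choose 2 : ℤ) + 2 * k * ((m + 1).choose 3 : ℤ)) := by
      rw [← zpow_natCast (e ^ N), ← zpow_mul, ← zpow_add₀ he, Nat.choose_succ_succ' (m + 1) 1,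
        Nat.choose_succ_succ' (m + 1) 2, Nat.choose_one_right]
      congr 1
      push_cast
      ring
    rw [hg, hf, hexp, Nat.choose_succ_succ' (m + 1) 1, Nat.choose_one_right, pow_add D]
    simp only [prod_div_distrib, prod_mul_distrib, prod_const, card_range]
    simp only [div_eq_mul_inv, mul_inv]
    ring



/-- **Theorem (reciprocal entries).** For `P = 𝒫(x)(p,q,r;a,b,c)` and
`U = 𝒫(x)(0,0,1;a,b,c)` with `c ≠ 0`, if every `P_{s+k(n+i+j)}` (`0 ≤ i,j ≤ m`) is a
nonzero polynomial, then in `ℝ(x)`: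
`det([1/P_{s+k(n+i+j)}]) = (−1)^{(s+kn)C(m+1,2)} c^{(s+kn)C(m+1,2)+2kC(m+1,3)}
  Δ_𝒫^{C(m+1,2)} ∏_{i=0}^m U_{k(i+1)}^{2(m−i)} / ∏_{0≤i,j≤m} P_{s+k(n+i+j)}`. -/
theorem det_reciprocal_matrix_recurrence_polynomials
    (s k n : ℤ) (m : ℕ) (hm : 1 ≤ m)
    (p q r a b c : ℝ) (hc : c ≠ 0)
    (P U : ℤ → Polynomial ℝ)
    (hP0 : P 0 = Polynomial.C p) (hP1 : P 1 = Polynomial.C q * X + Polynomial.C r)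
    (hPrec : ∀ n : ℤ, P (n + 2) = (Polynomial.C a * X + Polynomial.C b) * P (n + 1)
      + Polynomial.C c * P n)
    (hU0 : U 0 = 0) (hU1 : U 1 = 1)
    (hUrec : ∀ n : ℤ, U (n + 2) = (Polynomial.C a * X + Polynomial.C b) * U (n + 1)
      + Polynomial.C c * U n)
    (hne : ∀ i j : Fin (m + 1), P (s + k * (n + i.1 + j.1)) ≠ 0) :
    Matrix.det (Matrix.of fun i j : Fin (m + 1) =>
        (algebraMap (Polynomial ℝ) (RatFunc ℝ) (P (s + k * (n + i.1 + j.1))))⁻¹)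
      = ((-1 : RatFunc ℝ) ^ ((s + k * n) * (Nat.choose (m + 1) 2 : ℤ))
          * (algebraMap ℝ (RatFunc ℝ) c)
              ^ ((s + k * n) * (Nat.choose (m + 1) 2 : ℤ)
                  + 2 * k * (Nat.choose (m + 1) 3 : ℤ))
          * (algebraMap (Polynomial ℝ) (RatFunc ℝ)
              (Polynomial.C (q ^ 2 - a * p * q) * X ^ 2
                + Polynomial.C (2 * q * r - a * p * r - b * p * q) * X
                + Polynomial.C (r ^ 2 - b * p * r - c * p ^ 2))) ^ (Nat.choose (m + 1) 2)
          * ∏ i ∈ Finset.range (m + 1),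
              (algebraMap (Polynomial ℝ) (RatFunc ℝ) (U (k * ((i : ℤ) + 1))))
                ^ (2 * (m - i)))
        / ∏ i ∈ Finset.range (m + 1), ∏ j ∈ Finset.range (m + 1),
            algebraMap (Polynomial ℝ) (RatFunc ℝ) (P (s + k * (n + i + j))) := by
  set A := algebraMap ℝ[X] (RatFunc ℝ) with hA
  have hcK : algebraMap ℝ (RatFunc ℝ) c = A (C c) :=
    IsScalarTower.algebraMap_apply ℝ ℝ[X] (RatFunc ℝ) c
  have hc' : A (C c) ≠ 0 := by
    simpa [hA] using hc
  have hneg : -A (C c) ≠ 0 := neg_ne_zero.mpr hc'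
  have hD : A (P 1) ^ 2 - A (P 0) * A (P 2) =
      A (C (q ^ 2 - a * p * q) * X ^ 2 + C (2 * q * r - a * p * r - b * p * q) * X
        + C (r ^ 2 - b * p * r - c * p ^ 2)) := by
    have h2 := hPrec 0
    rw [zero_add, zero_add] at h2
    rw [h2, hP1, hP0, ← map_pow, ← map_mul, ← map_sub]
    congr 1
    simp only [map_sub, map_mul, map_pow, map_ofNat]
    ring
  have hcat := mul_sub_mul_of_linear_recurrence (l := A (C a * X + C b)) hc'
    (f := fun n => A (P n)) (g := fun n => A (U n))
    (fun n => by rw [hPrec, map_add, map_mul, map_mul])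
    (fun n => by rw [hUrec, map_add, map_mul, map_mul])
    (by simp [hU0]) (by simp [hU1])
  have hidx (i j : ℕ) : s + k * (n + i + j) = s + k * n + k * i + k * j := by ring
  simp only [hidx] at hne ⊢
  have hdet := det_inv_hankel_of_catalan (f := fun n => A (P n)) (g := fun n => A (U n))
    hneg k hcat m (s + k * n)
    (fun i j => by simpa [hA] using hne i j)
  rw [hdet, hD, hcK, neg_eq_neg_one_mul, mul_zpow, zpow_add₀ (neg_ne_zero.mpr one_ne_zero),
    mul_assoc 2 k, zpow_mul (-1 : RatFunc ℝ) 2]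
  simp
end

section
/- Let m ≥ 1, let s, k, n be any integers, and let (d_i)_{1≤i≤m}, (e_i)_{1≤i≤m} be sequences of integers. Let (F_n(x))_{n∈ℤ} be the sequence of Fibonacci polynomials. Then det( [ ∏_{f=j+1}^{m} F_{s+k(n+i+d_f)}(x) · ∏_{g=1}^{j} F_{s+k(n+i+e_g)}(x) ]_{0≤i,j≤m} ) = (−1)^{(s+kn+1)·C(m+1,2) + k·C(m+1,3)} · ∏_{l=1}^{m} F_{kl}(x)^{m+1−l} · ∏_{1≤i≤j≤m} (−1)^{k·d_j} · F_{k(e_i−d_j)}(x), where C(·,·) are binomial coefficients; this is an identity of real polynomials. -/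
open Polynomial Finset

section BinaryForms

variable {R : Type*} [CommRing R]

/-- A product of binary linear forms is a binary form of the expected degree. -/
lemma exists_coeff_prod_linear_forms (s : Finset ℕ) (a b : ℕ → R) :
    ∃ c : ℕ → R, ∀ u v : R,
      ∏ f ∈ s, (a f * u + b f * v) = ∑ l ∈ range (#s + 1), c l * (u ^ l * v ^ (#s - l)) := by
  induction s using Finset.induction_on with
  | empty => exact ⟨fun _ => 1, by simp⟩
  | insert x s hx ih =>
    obtain ⟨c, hc⟩ := ih
    refine ⟨fun l => (if l = 0 then 0 else a x * c (l - 1)) +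
      if l = #s + 1 then 0 else b x * c l, fun u v => ?_⟩
    rw [prod_insert hx, card_insert_of_notMem hx, hc]
    simp only [add_mul, sum_add_distrib]
    rw [sum_range_succ' _ (#s + 1), sum_range_succ _ (#s + 1)]
    simp only [mul_sum, add_eq_zero, one_ne_zero, and_false, if_false, if_true, zero_mul, add_zero,
      add_tsub_cancel_right, Nat.add_sub_add_right]
    congr 1
    · exact sum_congr rfl fun l _ => by ring
    · refine sum_congr rfl fun l hl => ?_
      have hl := mem_range.mp hl
      rw [if_neg hl.ne, Nat.sub_add_comm (Nat.lt_succ_iff.mp hl)]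
      ring

/-- The product of the linear forms `a f * u + b f * v` for `j < f ≤ m` and
`a' g * u + b' g * v` for `1 ≤ g ≤ j`. -/
def mixedProd (m : ℕ) (a b a' b' : ℕ → R) (j : ℕ) (u v : R) : R :=
  (∏ f ∈ Icc (j + 1) m, (a f * u + b f * v)) * ∏ g ∈ Icc 1 j, (a' g * u + b' g * v)

lemma mixedProd_succ {m j : ℕ} (hj : j ≤ m) (a b a' b' : ℕ → R) (u v : R) :
    mixedProd (m + 1) a b a' b' j u v =
      (a (m + 1) * u + b (m + 1) * v) * mixedProd m a b a' b' j u v := by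
  rw [mixedProd, mixedProd, prod_Icc_succ_top (by omega)]
  ring

lemma exists_coeff_mixedProd {m j : ℕ} (hj : j ≤ m) (a b a' b' : ℕ → R) :
    ∃ c : ℕ → R, ∀ u v : R,
      mixedProd m a b a' b' j u v = ∑ l ∈ range (m + 1), c l * (u ^ l * v ^ (m - l)) := by
  obtain ⟨c, hc⟩ := exists_coeff_prod_linear_forms (Icc 1 m)
    (fun i => if i ≤ j then a' i else a i) (fun i => if i ≤ j then b' i else b i)
  refine ⟨c, fun u v => ?_⟩
  simp only [Nat.card_Icc, add_tsub_cancel_right] at hc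
  rw [← hc, mixedProd, mul_comm]
  have hIcc (k : ℕ) : Icc 1 k = Ioc 0 k := rfl
  have hIcc' : Icc (j + 1) m = Ioc j m := Icc_add_one_left_eq_Ioc j m
  rw [hIcc, hIcc, hIcc', ← prod_Ioc_consecutive _ (Nat.zero_le j) hj]
  congr 1
  · refine prod_congr rfl fun i hi => ?_
    simp [(mem_Ioc.mp hi).2]
  · refine prod_congr rfl fun i hi => ?_
    simp [(mem_Ioc.mp hi).1.not_ge]

lemma prod_Ioi_fin_eq_prod_range (n : ℕ) (G : ℕ → ℕ → R) :
    ∏ i : Fin n, ∏ j ∈ Ioi i, G i j = ∏ j ∈ range n, ∏ i ∈ range j, G i j := by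
  rw [prod_comm' (t' := univ) (s' := fun j => Iio j) (by simp), ← Fin.prod_univ_eq_prod_range
    (fun j => ∏ i ∈ range j, G i j)]
  refine prod_congr rfl fun j _ => ?_
  have h : range (j : ℕ) = (Iio j).map Fin.valEmbedding := by
    rw [Fin.map_valEmbedding_Iio]
    ext
    simp
  rw [h, prod_map]
  rfl

/-- The determinant of the values of `m + 1` binary forms of degree `m` factors through the
homogeneous Vandermonde determinant. -/
lemma exists_det_mixedProd_eq (m : ℕ) (a b a' b' : ℕ → R) :
    ∃ c : R, ∀ u v : ℕ → R,
      (Matrix.of fun i j : Fin (m + 1) => mixedProd m a b a' b' j (u i) (v i)).det =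
        (∏ j ∈ range (m + 1), ∏ i ∈ range j, (u j * v i - u i * v j)) * c := by
  have h (j : Fin (m + 1)) := exists_coeff_mixedProd (Nat.lt_succ_iff.mp j.2) a b a' b'
  choose c hc using h
  refine ⟨(Matrix.of fun l j : Fin (m + 1) => c j l).det, fun u v => ?_⟩
  rw [← prod_Ioi_fin_eq_prod_range (m + 1) fun i j => u j * v i - u i * v j,
    ← Matrix.det_projVandermonde (fun i : Fin (m + 1) => u i) (fun i => v i), ← Matrix.det_mul]
  congr 1
  ext i j
  rw [Matrix.of_apply, hc, Matrix.mul_apply,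
    ← Fin.sum_univ_eq_sum_range fun l => c j l * (u i ^ l * v i ^ (m - l))]
  refine sum_congr rfl fun l _ => ?_
  rw [Matrix.projVandermonde_apply, Matrix.of_apply, Fin.val_rev, Nat.add_sub_add_right]
  ring

/-- If the last point is the zero of the last form `a (m + 1) * u + b (m + 1) * v`, the determinant
reduces to one of smaller size. -/
lemma det_mixedProd_succ_of_root (m : ℕ) (a b a' b' u v : ℕ → R)
    (hu : u (m + 1) = b (m + 1)) (hv : v (m + 1) = -a (m + 1)) :
    (Matrix.of fun i j : Fin (m + 2) => mixedProd (m + 1) a b a' b' j (u i) (v i)).det =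
      (∏ i ∈ range (m + 1), (u (m + 1) * v i - u i * v (m + 1))) *
        (Matrix.of fun i j : Fin (m + 1) => mixedProd m a b a' b' j (u i) (v i)).det *
        ∏ i ∈ Icc 1 (m + 1), (a' i * b (m + 1) - b' i * a (m + 1)) := by
  rw [Matrix.det_succ_row _ (Fin.last _), Fin.sum_univ_castSucc, sum_eq_zero, zero_add]
  · rw [← Fin.prod_univ_eq_prod_range fun i => u (m + 1) * v i - u i * v (m + 1),
      ← Matrix.det_mul_column]
    have hsub : (Matrix.of fun i j : Fin (m + 2) =>
          mixedProd (m + 1) a b a' b' j (u i) (v i)).submatrix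
          (Fin.last (m + 1)).succAbove (Fin.last (m + 1)).succAbove =
        Matrix.of fun i j : Fin (m + 1) => (u (m + 1) * v i - u i * v (m + 1)) *
          (Matrix.of fun i j : Fin (m + 1) => mixedProd m a b a' b' j (u i) (v i)) i j := by
      ext i j
      simp only [Matrix.submatrix_apply, Matrix.of_apply, Fin.succAbove_last, Fin.val_castSucc]
      rw [mixedProd_succ (Nat.lt_succ_iff.mp j.2), hu, hv]
      ring
    rw [hsub, ← two_mul, pow_mul, neg_one_sq, one_pow, one_mul, mul_comm]
    congr 1
    simp only [Matrix.of_apply, Fin.val_last, mixedProd, hu, hv]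
    simp [sub_eq_add_neg]
  · intro j _
    simp only [Matrix.of_apply, Fin.val_last, Fin.val_castSucc]
    rw [mixedProd_succ (Nat.lt_succ_iff.mp j.2), hu, hv]
    ring

/-- In an infinite domain there are infinitely many points avoiding the zero of a nonzero linear
form. -/
lemma exists_injective_linear_ne_zero [IsDomain R] [Infinite R] {a b : R}
    (h : a ≠ 0 ∨ b ≠ 0) : ∃ t : ℕ → R, Function.Injective t ∧ ∀ i, a * t i + b ≠ 0 := by
  have hfin : {t : R | a * t + b = 0}.Finite := by
    refine Set.Subsingleton.finite fun x hx y hy => ?_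
    simp only [Set.mem_ofPred_eq] at hx hy
    have ha : a ≠ 0 := by
      rintro rfl
      simp_all
    exact mul_left_cancel₀ ha (by linear_combination hx - hy)
  let t := hfin.infinite_compl.natEmbedding
  exact ⟨fun i => t i, fun i j hij => t.injective (Subtype.ext hij), fun i => (t i).2⟩

/-- A homogeneous form of Krattenthaler's determinant evaluation: the Vandermonde determinant of
products of two families of linear forms. -/
theorem det_mixedProd [IsDomain R] [Infinite R] (m : ℕ) (a b a' b' u v : ℕ → R) :
    (Matrix.of fun i j : Fin (m + 1) => mixedProd m a b a' b' j (u i) (v i)).det =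
      (∏ j ∈ range (m + 1), ∏ i ∈ range j, (u j * v i - u i * v j)) *
        ∏ j ∈ Icc 1 m, ∏ i ∈ Icc 1 j, (a' i * b j - b' i * a j) := by
  induction m generalizing u v with
  | zero => simp [mixedProd]
  | succ m ih =>
    by_cases h : a (m + 1) ≠ 0 ∨ b (m + 1) ≠ 0
    · obtain ⟨c, hc⟩ := exists_det_mixedProd_eq (m + 1) a b a' b'
      obtain ⟨t, htinj, ht⟩ := exists_injective_linear_ne_zero h
      suffices hcoef : c = ∏ j ∈ Icc 1 (m + 1), ∏ i ∈ Icc 1 j, (a' i * b j - b' i * a j) by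
        rw [hc, hcoef]
      let p : ℕ → R := fun i => if i = m + 1 then b (m + 1) else t i
      let q : ℕ → R := fun i => if i = m + 1 then -a (m + 1) else 1
      have hp : p (m + 1) = b (m + 1) := if_pos rfl
      have hq : q (m + 1) = -a (m + 1) := if_pos rfl
      have hp' {i : ℕ} (hi : i < m + 1) : p i = t i := if_neg hi.ne
      have hq' {i : ℕ} (hi : i < m + 1) : q i = 1 := if_neg hi.ne
      have hdet := (hc p q).symm.trans (det_mixedProd_succ_of_root m a b a' b' p q hp hq)
      rw [ih] at hdet
      have hne : ∏ j ∈ range (m + 2), ∏ i ∈ range j, (p j * q i - p i * q j) ≠ 0 := by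
        rw [prod_range_succ]
        refine mul_ne_zero (prod_ne_zero_iff.mpr fun j hj => prod_ne_zero_iff.mpr fun i hi => ?_)
          (prod_ne_zero_iff.mpr fun i hi => ?_)
        · rw [mem_range] at hi hj
          rw [hp' hj, hq' hj, hp' (hi.trans hj), hq' (hi.trans hj), mul_one, mul_one, sub_ne_zero]
          exact fun hij => hi.ne' (htinj hij)
        · rw [mem_range] at hi
          rw [hp, hq, hp' hi, hq' hi]
          convert ht i using 1
          ring
      refine mul_left_cancel₀ hne ?_
      rw [hdet, prod_range_succ _ (m + 1), prod_Icc_succ_top (by omega)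
        fun j => ∏ i ∈ Icc 1 j, (a' i * b j - b' i * a j)]
      ring
    · push Not at h
      rw [Matrix.det_eq_zero_of_column_eq_zero 0, prod_Icc_succ_top (by omega)]
      · simp [h, prod_const]
      · intro i
        simp [mixedProd_succ, h]

end BinaryForms

section FibonacciPolynomials

variable {F : ℤ → ℝ[X]}

lemma fib_poly_add (hF0 : F 0 = 0) (hF1 : F 1 = 1)
    (hFrec : ∀ n : ℤ, F (n + 2) = X * F (n + 1) + F n) (p q : ℤ) :
    F (p + q) = F (q + 1) * F p + F q * F (p - 1) := by
  suffices h : F (p + q) = F (q + 1) * F p + F q * F (p - 1) ∧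
      F (p + q + 1) = F (q + 2) * F p + F (q + 1) * F (p - 1) from h.1
  induction q using Int.induction_on with
  | zero =>
    have h1 := hFrec 0
    have h2 := hFrec (p - 1)
    rw [show p - 1 + 2 = p + 1 by ring, show p - 1 + 1 = p by ring] at h2
    simp only [zero_add, add_zero] at h1 ⊢
    rw [h1, h2, hF0, hF1]
    constructor <;> ring
  | succ q ih =>
    have h1 := hFrec (q + 1)
    have h2 := hFrec (p + q)
    have h3 := hFrec q
    rw [show (q : ℤ) + 1 + 2 = q + 3 by ring, show (q : ℤ) + 1 + 1 = q + 2 by ring] at h1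
    rw [show (q : ℤ) + 1 + 2 = q + 3 by ring, show (q : ℤ) + 1 + 1 = q + 2 by ring,
      show p + (q + 1 : ℤ) = p + q + 1 by ring, show p + q + 1 + 1 = p + (q : ℤ) + 2 by ring]
    refine ⟨ih.2, ?_⟩
    rw [h2, h1, ih.1, ih.2, h3]
    ring
  | pred q ih =>
    have h1 := hFrec (-q - 1)
    have h2 := hFrec (p + (-q - 1))
    have h3 := hFrec (-q)
    rw [show -(q : ℤ) - 1 + 2 = -q + 1 by ring, show -(q : ℤ) - 1 + 1 = -q by ring] at h1
    rw [show p + (-(q : ℤ) - 1) + 2 = p + -q + 1 by ring,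
      show p + (-(q : ℤ) - 1) + 1 = p + -q by ring] at h2
    rw [show -(q : ℤ) - 1 + 2 = -q + 1 by ring, show -(q : ℤ) - 1 + 1 = -q by ring,
      show p + (-(q : ℤ) - 1) + 1 = p + -q by ring]
    refine ⟨?_, ih.1⟩
    linear_combination ih.2 - X * ih.1 - h2 + F p * h3 + F (p - 1) * h1

lemma C_neg_one_zpow_add (p q : ℤ) :
    (C ((-1 : ℝ) ^ (p + q))) = C ((-1 : ℝ) ^ p) * C ((-1 : ℝ) ^ q) := by
  rw [zpow_add₀ (by norm_num), C_mul]

/-- d'Ocagne's identity for Fibonacci polynomials. -/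
lemma fib_poly_dOcagne (hF0 : F 0 = 0) (hF1 : F 1 = 1)
    (hFrec : ∀ n : ℤ, F (n + 2) = X * F (n + 1) + F n) (p q : ℤ) :
    F q * F (p + 1) - F (q + 1) * F p = C ((-1 : ℝ) ^ p) * F (q - p) := by
  have hstep (p q : ℤ) : F (q + 1) * F (p + 2) - F (q + 2) * F (p + 1) =
      -(F q * F (p + 1) - F (q + 1) * F p) := by
    rw [hFrec, hFrec]
    ring
  induction p using Int.induction_on generalizing q with
  | zero => simp [hF0, hF1]
  | succ p ih =>
    have h := hstep p (q - 1)
    rw [ih, show q - 1 + 2 = q + 1 by ring, show q - 1 + 1 = q by ring] at h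
    rw [show (p : ℤ) + 1 + 1 = p + 2 by ring, h, C_neg_one_zpow_add,
      show q - 1 - (p : ℤ) = q - (p + 1) by ring]
    simp
  | pred p ih =>
    have h := hstep (-p - 1) q
    have h2 := ih (q + 1)
    rw [show -(p : ℤ) - 1 + 2 = -p + 1 by ring, show -(p : ℤ) - 1 + 1 = -p by ring] at h
    rw [show q + 1 + 1 = q + 2 by ring, h] at h2
    rw [show -(p : ℤ) - 1 + 1 = -p by ring, sub_eq_add_neg (-(p : ℤ)) 1, C_neg_one_zpow_add,
      show q - (-(p : ℤ) + -1) = q + 1 - -p by ring]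
    rw [← sub_eq_add_neg]
    simp only [zpow_neg, zpow_one, inv_neg, inv_one, C_neg, C_1] at h2 ⊢
    linear_combination -h2

lemma prod_range_fib_poly_diff (k A : ℤ) (m : ℕ) :
    ∏ i ∈ range m, (C ((-1 : ℝ) ^ (A + k * i)) * F (k * (m - i : ℤ))) =
      C ((-1 : ℝ) ^ (A * m + k * (m.choose 2 : ℤ))) * ∏ l ∈ Icc 1 m, F (k * l) := by
  rw [prod_mul_distrib]
  congr 1
  · induction m with
    | zero => simp
    | succ m ih =>
      rw [prod_range_succ, ih, ← C_neg_one_zpow_add, Nat.choose_succ_succ' m 1, Nat.choose_one_right]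
      congr 2
      push_cast
      ring
  · rw [← prod_range_reflect, range_eq_Ico, prod_Ico_eq_prod_range, ← Ico_add_one_right_eq_Icc,
      prod_Ico_eq_prod_range]
    refine prod_congr (by simp) fun i hi => ?_
    have hi : i < m := by simpa using hi
    congr 2
    push_cast [show 0 + i ≤ m - 1 by omega, show 1 ≤ m by omega]
    ring

lemma prod_prod_fib_poly_diff (k A : ℤ) (m : ℕ) :
    ∏ j ∈ range (m + 1), ∏ i ∈ range j, (C ((-1 : ℝ) ^ (A + k * i)) * F (k * (j - i : ℤ))) =
      C ((-1 : ℝ) ^ (A * ((m + 1).choose 2 : ℤ) + k * ((m + 1).choose 3 : ℤ))) *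
        ∏ l ∈ Icc 1 m, F (k * l) ^ (m + 1 - l) := by
  induction m with
  | zero => simp [Nat.choose_eq_zero_of_lt]
  | succ m ih =>
    rw [prod_range_succ, ih, prod_range_fib_poly_diff, Nat.choose_succ_succ' (m + 1) 2,
      Nat.choose_succ_succ' (m + 1) 1, Nat.choose_one_right]
    have hprod : ∏ l ∈ Icc 1 (m + 1), F (k * l) ^ (m + 1 + 1 - l) =
        (∏ l ∈ Icc 1 m, F (k * l) ^ (m + 1 - l)) * ∏ l ∈ Icc 1 (m + 1), F (k * l) := by
      rw [prod_Icc_succ_top (by omega), prod_Icc_succ_top (by omega), ← mul_assoc,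
        ← prod_mul_distrib]
      congr 1
      · refine prod_congr rfl fun l hl => ?_
        rw [← pow_succ, Nat.sub_add_comm (by have := (mem_Icc.mp hl).2; omega)]
      · simp
    rw [hprod, mul_mul_mul_comm, ← C_neg_one_zpow_add]
    congr 3
    push_cast
    ring

lemma C_neg_one_zpow_mul_prod_pairs (m : ℕ) (G : ℕ → ℕ → ℝ[X]) :
    ∏ j ∈ Icc 1 m, ∏ i ∈ Icc 1 j, -G i j =
      C ((-1 : ℝ) ^ ((m + 1).choose 2 : ℤ)) * ∏ j ∈ Icc 1 m, ∏ i ∈ Icc 1 j, G i j := by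
  induction m with
  | zero => simp
  | succ m ih =>
    rw [prod_Icc_succ_top (by omega), ih, prod_neg,
      prod_Icc_succ_top (by omega) fun j => ∏ i ∈ Icc 1 j, G i j,
      Nat.choose_succ_succ' (m + 1) 1, Nat.choose_one_right, Nat.cast_add, C_neg_one_zpow_add]
    simp only [Nat.card_Icc, add_tsub_cancel_right, zpow_natCast, C_pow, C_neg, C_1]
    ring

end FibonacciPolynomials

/-- **Corollary 2, second identity.** For the Fibonacci polynomials `(F_n(x))_{n∈ℤ}`
and integer sequences `(d_i)`, `(e_i)`,
`det([∏_{f=j+1}^m F_{s+k(n+i+d_f)}(x) · ∏_{g=1}^j F_{s+k(n+i+e_g)}(x)])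
 = (−1)^{(s+kn+1)C(m+1,2)+kC(m+1,3)} ∏_{l=1}^m F_{kl}(x)^{m+1−l}
   · ∏_{1≤i≤j≤m} (−1)^{k d_j} F_{k(e_i−d_j)}(x)`. -/
theorem det_product_matrix_fibonacci_polynomials
    (m : ℕ) (hm : 1 ≤ m) (s k n : ℤ) (d e : ℕ → ℤ)
    (F : ℤ → Polynomial ℝ)
    (hF0 : F 0 = 0) (hF1 : F 1 = 1)
    (hFrec : ∀ n : ℤ, F (n + 2) = X * F (n + 1) + F n) :
    Matrix.det (Matrix.of fun i j : Fin (m + 1) =>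
        (∏ f ∈ Finset.Icc (j.1 + 1) m, F (s + k * (n + i.1 + d f)))
          * ∏ g ∈ Finset.Icc 1 j.1, F (s + k * (n + i.1 + e g)))
      = Polynomial.C ((-1 : ℝ)
            ^ ((s + k * n + 1) * (Nat.choose (m + 1) 2 : ℤ)
                + k * (Nat.choose (m + 1) 3 : ℤ)))
        * (∏ l ∈ Finset.Icc 1 m, (F (k * (l : ℤ))) ^ (m + 1 - l))
        * ∏ j ∈ Finset.Icc 1 m, ∏ i ∈ Finset.Icc 1 j,
            (Polynomial.C ((-1 : ℝ) ^ (k * d j)) * F (k * (e i - d j))) := by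
  let u : ℕ → ℝ[X] := fun i => F (s + k * (n + i))
  let v : ℕ → ℝ[X] := fun i => F (s + k * (n + i) - 1)
  have hentry (i : ℕ) (t : ℤ) :
      F (s + k * (n + i + t)) = F (k * t + 1) * u i + F (k * t) * v i := by
    rw [← fib_poly_add hF0 hF1 hFrec]
    ring_nf
  have huv (i j : ℕ) : u j * v i - u i * v j =
      C ((-1 : ℝ) ^ (s + k * n + k * i)) * F (k * (j - i : ℤ)) := by
    have h := fib_poly_dOcagne hF0 hF1 hFrec (s + k * (n + i) - 1) (s + k * (n + j) - 1)
    simp only [sub_add_cancel] at h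
    rw [show s + k * n + k * (i : ℤ) = s + k * (n + i) - 1 + 1 by ring, C_neg_one_zpow_add _ 1,
      show k * (j - i : ℤ) = s + k * (n + j) - 1 - (s + k * (n + i) - 1) by ring]
    simp only [zpow_one, C_neg, C_1]
    linear_combination -h
  have hde (i j : ℕ) : F (k * e i + 1) * F (k * d j) - F (k * e i) * F (k * d j + 1) =
      -(C ((-1 : ℝ) ^ (k * d j)) * F (k * (e i - d j))) := by
    rw [mul_sub, ← fib_poly_dOcagne hF0 hF1 hFrec]
    ring
  have hdet := det_mixedProd m (fun i => F (k * d i + 1)) (fun i => F (k * d i))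
    (fun i => F (k * e i + 1)) (fun i => F (k * e i)) u v
  simp only [mixedProd, ← hentry, huv, hde] at hdet
  rw [hdet, prod_prod_fib_poly_diff, C_neg_one_zpow_mul_prod_pairs,
    show (s + k * n + 1) * ((m + 1).choose 2 : ℤ) + k * ((m + 1).choose 3 : ℤ) =
      (s + k * n) * ((m + 1).choose 2 : ℤ) + k * ((m + 1).choose 3 : ℤ) + ((m + 1).choose 2 : ℤ)
      by ring, C_neg_one_zpow_add _ ((m + 1).choose 2 : ℤ)]
  ring
end
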